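/- For i = 1, 2, let x_{n,i} denote the indicator random variable of the event that vertex i belongs to class 1 and is isolated in G(n; μ, K_n, P_n, α_n). Consider a scaling such that Λ_1(n) = c_n · (log n)/n for every n, where c_n → c and 0 < c < 1. Then limsup_{n → ∞} E[x_{n,1} · x_{n,2}] / (E[x_{n,1}])^2 ≤ 1. -/

import Mathlib

open Filter Real

noncomputable section

namespace HetKey

/-- The set of ordered index pairs `x < y` (one Bernoulli coin per unordered pair). -/
abbrev Pairs (n : ℕ) : Type := {p : Fin n × Fin n // p.1 < p.2}

/-- A configuration of the randomness: the class of each vertex, the key ring of each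
vertex (a subset of the key pool `{1,…,P}`), and the Bernoulli link coins. -/
abbrev Config (n r P : ℕ) : Type :=
  (Fin n → Fin r) × (Fin n → Finset (Fin P)) × (Pairs n → Bool)

/-- Weight of a key ring under the uniform distribution on `k`-subsets of the pool. -/
def keyWeight (P k : ℕ) (s : Finset (Fin P)) : ℝ :=
  if s.card = k then ((P.choose k : ℝ))⁻¹ else 0

/-- Probability weight of a configuration: classes are i.i.d. with law `μ`, key rings are
(conditionally) uniform `K (class)`-subsets, link coins are i.i.d. Bernoulli(`α`). -/
def weight {n r P : ℕ} (μ : Fin r → ℝ) (K : Fin r → ℕ) (α : ℝ)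
    (cfg : Config n r P) : ℝ :=
  (∏ x, μ (cfg.1 x) * keyWeight P (K (cfg.1 x)) (cfg.2.1 x)) *
    ∏ p, (if cfg.2.2 p then α else 1 - α)

open scoped Classical in
/-- Probability of an event in `G(n; μ, K, P, α)`. -/
def Pr {n r P : ℕ} (μ : Fin r → ℝ) (K : Fin r → ℕ) (α : ℝ)
    (E : Config n r P → Prop) : ℝ :=
  ∑ cfg, if E cfg then weight μ K α cfg else 0

/-- Expectation of a random variable on the configuration space. -/
def expect {n r P : ℕ} (μ : Fin r → ℝ) (K : Fin r → ℕ) (α : ℝ)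
    (X : Config n r P → ℝ) : ℝ :=
  ∑ cfg, weight μ K α cfg * X cfg

/-- The Bernoulli coin attached to the unordered pair `{x, y}`. -/
def coin {n : ℕ} (b : Pairs n → Bool) (x y : Fin n) : Bool :=
  if h : x < y then b ⟨(x, y), h⟩
  else if h' : y < x then b ⟨(y, x), h'⟩
  else false

/-- Adjacency in `G(n; μ, K, P, α)`: distinct vertices, intersecting key rings, and an
operational (non-failed) link. -/
def adj {n r P : ℕ} (cfg : Config n r P) (x y : Fin n) : Prop :=
  x ≠ y ∧ (cfg.2.1 x ∩ cfg.2.1 y).Nonempty ∧ coin cfg.2.2 x y = true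

/-- A vertex is isolated if it has no neighbours. -/
def isolated {n r P : ℕ} (cfg : Config n r P) (x : Fin n) : Prop :=
  ∀ y, ¬ adj cfg x y

/-- Connectivity: every pair of vertices is joined by a path. -/
def conn {n r P : ℕ} (cfg : Config n r P) : Prop :=
  ∀ x y : Fin n, Relation.ReflTransGen (adj cfg) x y

/-- `p_{ij}`: the probability that a uniform `K_i`-subset and an independent uniform
`K_j`-subset of a pool of size `P` intersect. -/
def pEdge (P Ki Kj : ℕ) : ℝ :=
  1 - ((P - Ki).choose Kj : ℝ) / (P.choose Kj : ℝ)

/-- `λ_i = Σ_j μ_j p_{ij}`. -/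
def lam {r : ℕ} (μ : Fin r → ℝ) (K : Fin r → ℕ) (P : ℕ) (i : Fin r) : ℝ :=
  ∑ j, μ j * pEdge P (K i) (K j)

/-- `Λ_i = α λ_i`. -/
def Lam {r : ℕ} (μ : Fin r → ℝ) (K : Fin r → ℕ) (P : ℕ) (α : ℝ) (i : Fin r) : ℝ :=
  α * lam μ K P i

end HetKey

namespace HetKey

/-- Indicator that two key rings share a key. -/
def meetInd {P : ℕ} (S T : Finset (Fin P)) : ℝ :=
  if (S ∩ T).Nonempty then 1 else 0

/-- Probability that the link between vertices with key rings `S` and `T` is absent. -/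
def noLink {P : ℕ} (α : ℝ) (S T : Finset (Fin P)) : ℝ :=
  1 - α * meetInd S T

lemma meetInd_nonneg {P : ℕ} (S T : Finset (Fin P)) : 0 ≤ meetInd S T := by
  unfold meetInd; split_ifs <;> norm_num

lemma meetInd_le_one {P : ℕ} (S T : Finset (Fin P)) : meetInd S T ≤ 1 := by
  unfold meetInd; split_ifs <;> norm_num

lemma noLink_nonneg {P : ℕ} {α : ℝ} (hα0 : 0 ≤ α) (hα1 : α ≤ 1) (S T : Finset (Fin P)) :
    0 ≤ noLink α S T := by
  unfold noLink
  nlinarith [meetInd_nonneg S T, meetInd_le_one S T]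

lemma keyWeight_nonneg (P k : ℕ) (s : Finset (Fin P)) : 0 ≤ keyWeight P k s := by
  unfold keyWeight; split_ifs <;> positivity

lemma sum_keyWeight_subset (P k : ℕ) (U : Finset (Fin P)) :
    ∑ s, keyWeight P k s * (if s ⊆ U then 1 else 0) = (U.card.choose k : ℝ) / P.choose k := by
  have : ∀ s : Finset (Fin P), keyWeight P k s * (if s ⊆ U then 1 else 0) =
      if s ∈ Finset.powersetCard k U then ((P.choose k : ℝ))⁻¹ else 0 := by
    intro s
    simp only [Finset.mem_powersetCard, keyWeight]
    by_cases h1 : s ⊆ U <;> by_cases h2 : s.card = k <;> simp [h1, h2]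
  simp_rw [this]
  rw [Finset.sum_ite_mem, Finset.univ_inter, Finset.sum_const, Finset.card_powersetCard,
    nsmul_eq_mul, div_eq_mul_inv]

lemma sum_keyWeight {P k : ℕ} (hk : k ≤ P) : ∑ s, keyWeight P k s = 1 := by
  have h := sum_keyWeight_subset P k Finset.univ
  have : (P.choose k : ℝ) ≠ 0 := by exact_mod_cast (Nat.choose_pos hk).ne'
  simpa [this] using h

lemma meetInd_eq {P : ℕ} (S T : Finset (Fin P)) :
    meetInd S T = 1 - (if T ⊆ Sᶜ then 1 else 0) := by
  have : T ⊆ Sᶜ ↔ ¬ (S ∩ T).Nonempty := by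
    rw [Finset.not_nonempty_iff_eq_empty, ← Finset.disjoint_iff_inter_eq_empty,
      Finset.subset_compl_iff_disjoint_left]
  unfold meetInd
  by_cases h : (S ∩ T).Nonempty <;> simp [this, h]

lemma sum_keyWeight_meetInd {P k : ℕ} (hk : k ≤ P) (S : Finset (Fin P)) :
    ∑ s, keyWeight P k s * meetInd S s = pEdge P S.card k := by
  simp_rw [meetInd_eq, mul_sub, mul_one]
  rw [Finset.sum_sub_distrib, sum_keyWeight hk, sum_keyWeight_subset, pEdge,
    Finset.card_compl, Fintype.card_fin]

lemma pEdge_nonneg {P k : ℕ} (hk : k ≤ P) (a : ℕ) : 0 ≤ pEdge P a k := by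
  have : (0 : ℝ) < P.choose k := by exact_mod_cast (Nat.choose_pos hk)
  have h2 : ((P - a).choose k : ℝ) ≤ P.choose k := by
    exact_mod_cast Nat.choose_le_choose k (Nat.sub_le P a)
  rw [pEdge, sub_nonneg, div_le_one this]
  exact h2

lemma pEdge_le_one (P a k : ℕ) : pEdge P a k ≤ 1 := by
  rw [pEdge, sub_le_self_iff]
  positivity

lemma descFactorial_logConcave (P K k : ℕ) :
    (P - 2 * K).descFactorial k * P.descFactorial k ≤ (P - K).descFactorial k ^ 2 := by
  induction k with
  | zero => simp
  | succ k ih =>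
    simp only [Nat.descFactorial_succ]
    have h : (P - 2 * K - k) * (P - k) ≤ (P - K - k) ^ 2 := by
      rcases le_or_gt (P - 2 * K) k with h | h
      · simp [Nat.sub_eq_zero_of_le h]
      · obtain ⟨d, rfl⟩ : ∃ d, P = 2 * K + k + d := ⟨P - 2 * K - k, by omega⟩
        have e1 : 2 * K + k + d - 2 * K - k = d := by omega
        have e2 : 2 * K + k + d - k = 2 * K + d := by omega
        have e3 : 2 * K + k + d - K - k = K + d := by omega
        rw [e1, e2, e3]
        nlinarith
    calc _ = ((P - 2 * K - k) * (P - k)) *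
          ((P - 2 * K).descFactorial k * P.descFactorial k) := by ring
      _ ≤ (P - K - k) ^ 2 * (P - K).descFactorial k ^ 2 := Nat.mul_le_mul h ih
      _ = _ := by ring

lemma choose_logConcave (P K k : ℕ) :
    (P - 2 * K).choose k * P.choose k ≤ (P - K).choose k ^ 2 := by
  have h := descFactorial_logConcave P K k
  simp only [Nat.descFactorial_eq_factorial_mul_choose] at h
  have hf : 0 < k.factorial ^ 2 := by positivity
  refine Nat.le_of_mul_le_mul_left ?_ hf
  calc _ = _ := by ring
    _ ≤ _ := h
    _ = _ := by ring

/-- Hitting two disjoint sets of equal size is negatively correlated. -/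
lemma sum_keyWeight_meetInd_mul_le_sq {P k K : ℕ} (hk : k ≤ P) {S T : Finset (Fin P)}
    (hS : S.card = K) (hT : T.card = K) (hST : meetInd S T = 0) :
    ∑ s, keyWeight P k s * (meetInd S s * meetInd T s) ≤ pEdge P K k ^ 2 := by
  have hdisj : Disjoint S T := by
    rw [Finset.disjoint_iff_inter_eq_empty, ← Finset.not_nonempty_iff_eq_empty]
    intro h
    simp [meetInd, h] at hST
  have hcard : ((S ∪ T)ᶜ).card = P - 2 * K := by
    rw [Finset.card_compl, Fintype.card_fin, Finset.card_union_of_disjoint hdisj, hS, hT, two_mul]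
  have e : ∀ s, keyWeight P k s * (meetInd S s * meetInd T s) =
      keyWeight P k s * meetInd S s + keyWeight P k s * meetInd T s - keyWeight P k s +
      keyWeight P k s * (if s ⊆ (S ∪ T)ᶜ then 1 else 0) := by
    intro s
    have : s ⊆ (S ∪ T)ᶜ ↔ s ⊆ Sᶜ ∧ s ⊆ Tᶜ := by
      rw [Finset.compl_union, Finset.subset_inter_iff]
    simp only [meetInd_eq, this]
    by_cases h1 : s ⊆ Sᶜ <;> by_cases h2 : s ⊆ Tᶜ <;> simp [h1, h2]
  simp_rw [e]
  rw [Finset.sum_add_distrib, Finset.sum_sub_distrib, Finset.sum_add_distrib,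
    sum_keyWeight_meetInd hk, sum_keyWeight_meetInd hk, sum_keyWeight hk, sum_keyWeight_subset,
    hcard, hS, hT]
  have hpos : (0 : ℝ) < P.choose k := by exact_mod_cast (Nat.choose_pos hk)
  have hc : ((P - 2 * K).choose k : ℝ) * P.choose k ≤ ((P - K).choose k : ℝ) ^ 2 := by
    exact_mod_cast choose_logConcave P K k
  have : ((P - 2 * K).choose k : ℝ) / P.choose k ≤ (((P - K).choose k : ℝ) / P.choose k) ^ 2 := by
    rw [div_pow, div_le_div_iff₀ hpos (by positivity)]
    nlinarith
  simp only [pEdge]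
  nlinarith

lemma coin_mk {n : ℕ} (b : Pairs n → Bool) (p : Pairs n) : coin b p.1.1 p.1.2 = b p := by
  simp [coin, p.2]

lemma coin_comm {n : ℕ} (b : Pairs n → Bool) (x y : Fin n) : coin b x y = coin b y x := by
  unfold coin
  rcases lt_trichotomy x y with h | h | h
  · simp [h, h.not_gt]
  · simp [h]
  · simp [h, h.not_gt]

lemma adj_comm {n r P : ℕ} (cfg : Config n r P) (x y : Fin n) : adj cfg x y ↔ adj cfg y x := by
  unfold adj
  rw [Finset.inter_comm, coin_comm, ne_comm]

lemma forall_isolated_iff {n r P : ℕ} (cfg : Config n r P) (k : ℕ) :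
    (∀ x : Fin n, x.val < k → isolated cfg x) ↔
      ∀ p : Pairs n, ¬ (p.1.1.val < k ∧ (cfg.2.1 p.1.1 ∩ cfg.2.1 p.1.2).Nonempty ∧
        cfg.2.2 p = true) := by
  constructor
  · rintro h p ⟨h1, h2, h3⟩
    exact h _ h1 p.1.2 ⟨p.2.ne, h2, by rw [coin_mk, h3]⟩
  · intro h x hx y hxy
    wlog hlt : x < y generalizing x y
    · have hyx : y < x := lt_of_le_of_ne (not_lt.1 hlt) hxy.1.symm
      exact this y (lt_trans hyx hx) x ((adj_comm cfg x y).1 hxy) hyx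
    refine h ⟨(x, y), hlt⟩ ⟨hx, hxy.2.1, ?_⟩
    have := hxy.2.2
    rwa [coin_mk cfg.2.2 ⟨(x, y), hlt⟩] at this

open scoped Classical in
lemma sum_coins {n P : ℕ} (α : ℝ) (k : ℕ) (s : Fin n → Finset (Fin P)) :
    ∑ b : Pairs n → Bool, (∏ p, (if b p then α else 1 - α)) *
      (if ∀ p : Pairs n, ¬ (p.1.1.val < k ∧ (s p.1.1 ∩ s p.1.2).Nonempty ∧ b p = true)
        then (1 : ℝ) else 0) =
    ∏ p : Pairs n, (if p.1.1.val < k then noLink α (s p.1.1) (s p.1.2) else 1) := by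
  have e : ∀ b : Pairs n → Bool, (∏ p, (if b p then α else 1 - α)) *
      (if ∀ p : Pairs n, ¬ (p.1.1.val < k ∧ (s p.1.1 ∩ s p.1.2).Nonempty ∧ b p = true)
        then (1 : ℝ) else 0) =
      ∏ p, ((if b p then α else 1 - α) *
        (if ¬ (p.1.1.val < k ∧ (s p.1.1 ∩ s p.1.2).Nonempty ∧ b p = true)
          then (1 : ℝ) else 0)) := by
    intro b
    rw [Finset.prod_mul_distrib, Finset.prod_ite_zero]
    simp
  simp_rw [e]
  rw [← Fintype.prod_sum (fun (p : Pairs n) (c : Bool) => (if c then α else 1 - α) *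
        (if ¬ (p.1.1.val < k ∧ (s p.1.1 ∩ s p.1.2).Nonempty ∧ c = true)
          then (1 : ℝ) else 0))]
  refine Finset.prod_congr rfl fun p _ => ?_
  by_cases h1 : p.1.1.val < k <;> by_cases h2 : (s p.1.1 ∩ s p.1.2).Nonempty <;>
    simp [h1, h2, noLink, meetInd]

lemma prod_pairs {n : ℕ} (g : Fin n → Fin n → ℝ) :
    ∏ p : Pairs n, g p.1.1 p.1.2 = ∏ x, ∏ y, if x < y then g x y else 1 := by
  rw [← Fintype.prod_prod_type' (fun x y => if x < y then g x y else 1), ← Finset.prod_filter]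
  exact (Finset.prod_subtype (p := fun p : Fin n × Fin n => p.1 < p.2) _
    (by simp) (fun p => g p.1 p.2)).symm

/-- Joint weight of the class and key ring of a single vertex. -/
def vertexWeight {r P : ℕ} (μ : Fin r → ℝ) (K : Fin r → ℕ) (a : Fin r × Finset (Fin P)) : ℝ :=
  μ a.1 * keyWeight P (K a.1) a.2

lemma vertexWeight_nonneg {r P : ℕ} {μ : Fin r → ℝ} (hμ : ∀ i, 0 < μ i) (K : Fin r → ℕ)
    (a : Fin r × Finset (Fin P)) : 0 ≤ vertexWeight μ K a :=
  mul_nonneg (hμ _).le (keyWeight_nonneg _ _ _)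

open scoped Classical in
lemma expect_forall_isolated {n r P : ℕ} (μ : Fin r → ℝ) (K : Fin r → ℕ) (α : ℝ) (k : ℕ)
    (φ : (Fin n → Fin r) → ℝ) :
    expect (P := P) μ K α (fun cfg : Config n r P =>
      φ cfg.1 * if ∀ x : Fin n, x.val < k → isolated cfg x then 1 else 0) =
    ∑ f : Fin n → Fin r × Finset (Fin P), φ (fun x => (f x).1) *
      ((∏ x, vertexWeight μ K (f x)) * ∏ x, ∏ y, if x < y then
        (if x.val < k then noLink α (f x).2 (f y).2 else 1) else 1) := by
  unfold expect
  rw [Fintype.sum_prod_type]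
  simp_rw [Fintype.sum_prod_type]
  rw [← Fintype.sum_prod_type' (fun (t : Fin n → Fin r) (s : Fin n → Finset (Fin P)) =>
    ∑ b : Pairs n → Bool, weight μ K α (t, s, b) * (φ t *
      if ∀ x : Fin n, x.val < k → isolated ((t, s, b) : Config n r P) x then 1 else 0))]
  symm
  refine Fintype.sum_equiv (Equiv.arrowProdEquivProdArrow _ _ _) _ _ fun f => ?_
  rw [← prod_pairs (fun x y => if x.val < k then noLink α (f x).2 (f y).2 else 1),
    ← sum_coins α k (fun x => (f x).2), Finset.mul_sum, Finset.mul_sum]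
  refine Finset.sum_congr rfl fun b _ => ?_
  simp only [forall_isolated_iff, weight, vertexWeight, Equiv.arrowProdEquivProdArrow]
  simp only [Equiv.coe_fn_mk]
  ring

lemma sum_cons {β : Type*} [Fintype β] {m : ℕ} (H : (Fin (m + 1) → β) → ℝ) :
    ∑ f, H f = ∑ a, ∑ f' : Fin m → β, H (Fin.cons a f') := by
  rw [← Fintype.sum_prod_type' (fun a f' => H (Fin.cons a f'))]
  exact (Fintype.sum_equiv (Fin.consEquiv fun _ => β) _ _ fun _ => rfl).symm

lemma weight_nonneg {n r P : ℕ} {μ : Fin r → ℝ} (hμ : ∀ i, 0 < μ i) (K : Fin r → ℕ) {α : ℝ}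
    (hα0 : 0 ≤ α) (hα1 : α ≤ 1) (cfg : Config n r P) : 0 ≤ weight μ K α cfg := by
  refine mul_nonneg (Finset.prod_nonneg fun x _ => mul_nonneg (hμ _).le (keyWeight_nonneg _ _ _))
    (Finset.prod_nonneg fun p _ => ?_)
  split_ifs <;> linarith

lemma sum_vertexWeight_mul {r P : ℕ} (μ : Fin r → ℝ) (K : Fin r → ℕ)
    (F : Finset (Fin P) → ℝ) :
    ∑ a, vertexWeight μ K a * F a.2 = ∑ j, μ j * ∑ s, keyWeight P (K j) s * F s := by
  rw [Fintype.sum_prod_type]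
  simp_rw [vertexWeight, Finset.mul_sum, mul_assoc]

lemma sum_vertexWeight_class {r P : ℕ} (μ : Fin r → ℝ) (K : Fin r → ℕ) (i : Fin r)
    (F : Finset (Fin P) → ℝ) :
    ∑ a, vertexWeight μ K a * ((if a.1 = i then 1 else 0) * F a.2) =
      μ i * ∑ s, keyWeight P (K i) s * F s := by
  rw [Fintype.sum_prod_type, Finset.sum_eq_single i]
  · simp_rw [vertexWeight, Finset.mul_sum]
    simp [mul_assoc]
  · intro j _ hj
    simp [hj]
  · simp

open scoped Classical in
lemma expect_isolated {m r P : ℕ} (μ : Fin r → ℝ) (K : Fin r → ℕ) (α : ℝ) (i : Fin r)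
    (h0 : 0 < m + 1) :
    expect (n := m + 1) (P := P) μ K α (fun cfg =>
      if cfg.1 ⟨0, h0⟩ = i ∧ isolated cfg ⟨0, h0⟩ then (1 : ℝ) else 0) =
    μ i * ∑ S, keyWeight P (K i) S * (∑ a, vertexWeight μ K a * noLink α S a.2) ^ m := by
  have e : (fun cfg : Config (m + 1) r P =>
      if cfg.1 ⟨0, h0⟩ = i ∧ isolated cfg ⟨0, h0⟩ then (1 : ℝ) else 0) =
      fun cfg => (if cfg.1 0 = i then 1 else 0) *
        if ∀ x : Fin (m + 1), x.val < 1 → isolated cfg x then 1 else 0 := by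
    funext cfg
    have : (∀ x : Fin (m + 1), x.val < 1 → isolated cfg x) ↔ isolated cfg ⟨0, h0⟩ := by
      simp
    rw [ite_and, ← this]
    by_cases h : cfg.1 0 = i <;> simp [h]
  rw [e, expect_forall_isolated μ K α 1 (fun t => if t 0 = i then 1 else 0), sum_cons,
    ← sum_vertexWeight_class]
  refine Finset.sum_congr rfl fun a _ => ?_
  simp only [Fin.prod_univ_succ, Fin.cons_zero, Fin.cons_succ]
  simp only [Fintype.sum_pow, Finset.mul_sum]
  refine Finset.sum_congr rfl fun f _ => ?_
  by_cases ha : a.1 = i <;> simp [ha]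
  rw [Finset.prod_mul_distrib]
  ring

open scoped Classical in
lemma expect_isolated_mul {m r P : ℕ} (μ : Fin r → ℝ) (K : Fin r → ℕ) (α : ℝ) (i : Fin r)
    (h0 : 0 < m + 2) (h1 : 1 < m + 2) :
    expect (n := m + 2) (P := P) μ K α (fun cfg =>
      (if cfg.1 ⟨0, h0⟩ = i ∧ isolated cfg ⟨0, h0⟩ then (1 : ℝ) else 0) *
      (if cfg.1 ⟨1, h1⟩ = i ∧ isolated cfg ⟨1, h1⟩ then (1 : ℝ) else 0)) =
    μ i ^ 2 * ∑ S, keyWeight P (K i) S * ∑ T, keyWeight P (K i) T * (noLink α S T *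
      (∑ a, vertexWeight μ K a * (noLink α S a.2 * noLink α T a.2)) ^ m) := by
  have e : (fun cfg : Config (m + 2) r P =>
      (if cfg.1 ⟨0, h0⟩ = i ∧ isolated cfg ⟨0, h0⟩ then (1 : ℝ) else 0) *
      (if cfg.1 ⟨1, h1⟩ = i ∧ isolated cfg ⟨1, h1⟩ then (1 : ℝ) else 0)) =
      fun cfg => ((if cfg.1 0 = i then 1 else 0) * (if cfg.1 1 = i then 1 else 0)) *
        if ∀ x : Fin (m + 2), x.val < 2 → isolated cfg x then 1 else 0 := by
    funext cfg
    have : (∀ x : Fin (m + 2), x.val < 2 → isolated cfg x) ↔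
        isolated cfg 0 ∧ isolated cfg 1 := by
      simp [Fin.forall_fin_succ]
    have z0 : (⟨0, h0⟩ : Fin (m + 2)) = 0 := rfl
    have z1 : (⟨1, h1⟩ : Fin (m + 2)) = 1 := rfl
    simp only [this, z0, z1]
    by_cases c0 : cfg.1 0 = i <;> by_cases c1 : cfg.1 1 = i <;>
      by_cases d0 : isolated cfg 0 <;> by_cases d1 : isolated cfg 1 <;> simp [c0, c1, d0, d1]
  have er : μ i ^ 2 * ∑ S, keyWeight P (K i) S * ∑ T, keyWeight P (K i) T * (noLink α S T *
      (∑ a, vertexWeight μ K a * (noLink α S a.2 * noLink α T a.2)) ^ m) =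
      μ i * ∑ S, keyWeight P (K i) S * (μ i * ∑ T, keyWeight P (K i) T * (noLink α S T *
      (∑ a, vertexWeight μ K a * (noLink α S a.2 * noLink α T a.2)) ^ m)) := by
    simp only [Finset.mul_sum]
    exact Finset.sum_congr rfl fun _ _ => Finset.sum_congr rfl fun _ _ => by ring
  rw [e, expect_forall_isolated μ K α 2
    (fun t => (if t 0 = i then 1 else 0) * (if t 1 = i then 1 else 0)), sum_cons, er,
    ← sum_vertexWeight_class]
  refine Finset.sum_congr rfl fun a _ => ?_
  rw [sum_cons, ← sum_vertexWeight_class, Finset.mul_sum, Finset.mul_sum]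
  refine Finset.sum_congr rfl fun b _ => ?_
  simp only [Fintype.sum_pow, Finset.mul_sum]
  refine Finset.sum_congr rfl fun f _ => ?_
  simp only [Fin.prod_univ_succ, Fin.cons_zero, Fin.cons_succ, ← Fin.succ_zero_eq_one]
  have hlt : ∀ x : Fin m, (1 : Fin (m + 2)) < x.succ.succ := fun x => by simp [Fin.lt_def]
  by_cases ha : a.1 = i <;> by_cases hb : b.1 = i <;> simp [ha, hb, hlt]
  simp only [Finset.prod_mul_distrib]
  ring

lemma sum_vertexWeight_noLink {r P : ℕ} {μ : Fin r → ℝ} (hμ : ∑ i, μ i = 1) {K : Fin r → ℕ}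
    (hK : ∀ i, K i ≤ P) (α : ℝ) {i : Fin r} {S : Finset (Fin P)} (hS : S.card = K i) :
    ∑ a, vertexWeight μ K a * noLink α S a.2 = 1 - Lam μ K P α i := by
  rw [sum_vertexWeight_mul]
  simp_rw [noLink, mul_sub, mul_one, mul_left_comm _ α, Finset.sum_sub_distrib, ← Finset.mul_sum,
    sum_keyWeight (hK _), sum_keyWeight_meetInd (hK _), hS, mul_sub, mul_one,
    Finset.sum_sub_distrib, hμ, mul_left_comm _ α, ← Finset.mul_sum]
  rfl

lemma sum_vertexWeight_noLink_mul {r P : ℕ} {μ : Fin r → ℝ} (hμ : ∑ i, μ i = 1)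
    {K : Fin r → ℕ} (hK : ∀ i, K i ≤ P) (α : ℝ) {i : Fin r} {S T : Finset (Fin P)}
    (hS : S.card = K i) (hT : T.card = K i) :
    ∑ a, vertexWeight μ K a * (noLink α S a.2 * noLink α T a.2) =
      1 - 2 * Lam μ K P α i +
        α ^ 2 * ∑ j, μ j * ∑ s, keyWeight P (K j) s * (meetInd S s * meetInd T s) := by
  have e : ∀ a : Fin r × Finset (Fin P), vertexWeight μ K a * (noLink α S a.2 * noLink α T a.2) =
      vertexWeight μ K a * noLink α S a.2 + vertexWeight μ K a * noLink α T a.2 -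
        vertexWeight μ K a * 1 + α ^ 2 * (vertexWeight μ K a * (meetInd S a.2 * meetInd T a.2)) := by
    intro a
    simp only [noLink]
    ring
  simp_rw [e]
  rw [Finset.sum_add_distrib, Finset.sum_sub_distrib, Finset.sum_add_distrib,
    sum_vertexWeight_noLink hμ hK α hS, sum_vertexWeight_noLink hμ hK α hT, ← Finset.mul_sum,
    sum_vertexWeight_mul μ K (fun s => meetInd S s * meetInd T s),
    sum_vertexWeight_mul μ K (fun _ => 1)]
  simp_rw [mul_one, sum_keyWeight (hK _), mul_one, hμ]
  ring

lemma sum_keyWeight_noLink_pow {m r P : ℕ} {μ : Fin r → ℝ} (hμ : ∑ i, μ i = 1) {K : Fin r → ℕ}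
    (hK : ∀ i, K i ≤ P) (α : ℝ) (i : Fin r) :
    μ i * ∑ S, keyWeight P (K i) S * (∑ a, vertexWeight μ K a * noLink α S a.2) ^ m =
      μ i * (1 - Lam μ K P α i) ^ m := by
  have : ∀ S, keyWeight P (K i) S * (∑ a, vertexWeight μ K a * noLink α S a.2) ^ m =
      keyWeight P (K i) S * (1 - Lam μ K P α i) ^ m := by
    intro S
    by_cases hS : S.card = K i
    · rw [sum_vertexWeight_noLink hμ hK α hS]
    · simp [keyWeight, hS]
  simp_rw [this, ← Finset.sum_mul, sum_keyWeight (hK i), one_mul]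

lemma sum_mul_sq_le {r : ℕ} {μ p : Fin r → ℝ} (hμ : ∀ i, 0 < μ i) (hp : ∀ i, 0 ≤ p i) :
    ∑ j, μ j * p j ^ 2 ≤ (∑ j, (μ j)⁻¹) * (∑ j, μ j * p j) ^ 2 := by
  rw [Finset.sum_mul]
  refine Finset.sum_le_sum fun j _ => ?_
  have h1 : μ j * p j ≤ ∑ j, μ j * p j :=
    Finset.single_le_sum (f := fun j => μ j * p j)
      (fun i _ => mul_nonneg (hμ i).le (hp i)) (Finset.mem_univ j)
  calc μ j * p j ^ 2 = (μ j)⁻¹ * (μ j * p j) ^ 2 := by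
        field_simp [(hμ j).ne']
    _ ≤ _ := by
        have := hμ j
        have := hp j
        gcongr

lemma sum_keyWeight_noLink_mul_le {m r P : ℕ} {μ : Fin r → ℝ} (hμ0 : ∀ i, 0 < μ i)
    (hμ : ∑ i, μ i = 1) {K : Fin r → ℕ} (hK : ∀ i, K i ≤ P) {α : ℝ} (hα0 : 0 < α)
    (hα1 : α < 1) (i : Fin r) :
    ∑ S, keyWeight P (K i) S * ∑ T, keyWeight P (K i) T * (noLink α S T *
      (∑ a, vertexWeight μ K a * (noLink α S a.2 * noLink α T a.2)) ^ m) ≤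
    (1 - pEdge P (K i) (K i)) *
      ((1 - Lam μ K P α i) ^ 2 + (∑ j, (μ j)⁻¹) * Lam μ K P α i ^ 2) ^ m +
    pEdge P (K i) (K i) * ((1 - Lam μ K P α i) ^ 2 + α * Lam μ K P α i) ^ m := by
  set L := Lam μ K P α i with hL
  set A := (1 - L) ^ 2 + (∑ j, (μ j)⁻¹) * L ^ 2 with hA
  set B := (1 - L) ^ 2 + α * L with hB
  have hp0 : ∀ j, 0 ≤ pEdge P (K i) (K j) := fun j => pEdge_nonneg (hK j) _
  have hlam : 0 ≤ lam μ K P i := Finset.sum_nonneg fun j _ => mul_nonneg (hμ0 j).le (hp0 j)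
  have hL0 : 0 ≤ L := mul_nonneg hα0.le hlam
  have key : ∀ S T : Finset (Fin P), S.card = K i → T.card = K i →
      noLink α S T * (∑ a, vertexWeight μ K a * (noLink α S a.2 * noLink α T a.2)) ^ m ≤
      (1 - meetInd S T) * A ^ m + meetInd S T * B ^ m := by
    intro S T hS hT
    have hb0 : 0 ≤ ∑ a, vertexWeight μ K a * (noLink α S a.2 * noLink α T a.2) :=
      Finset.sum_nonneg fun a _ => mul_nonneg (vertexWeight_nonneg hμ0 K a)
        (mul_nonneg (noLink_nonneg hα0.le hα1.le _ _) (noLink_nonneg hα0.le hα1.le _ _))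
    have hb := sum_vertexWeight_noLink_mul hμ hK α hS hT
    set b := ∑ a, vertexWeight μ K a * (noLink α S a.2 * noLink α T a.2)
    set Q := ∑ j, μ j * ∑ s, keyWeight P (K j) s * (meetInd S s * meetInd T s) with hQ
    rcases (by unfold meetInd; split_ifs <;> simp :
      meetInd S T = 0 ∨ meetInd S T = 1) with h | h
    · have hQ1 : Q ≤ (∑ j, (μ j)⁻¹) * lam μ K P i ^ 2 := by
        refine le_trans (Finset.sum_le_sum fun j _ => ?_) (sum_mul_sq_le hμ0 hp0)
        exact mul_le_mul_of_nonneg_left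
          (sum_keyWeight_meetInd_mul_le_sq (hK j) hS hT h) (hμ0 j).le
      have hbA : b ≤ A := by
        have h3 := mul_le_mul_of_nonneg_left hQ1 (sq_nonneg α)
        have h4 : α ^ 2 * ((∑ j, (μ j)⁻¹) * lam μ K P i ^ 2) = (∑ j, (μ j)⁻¹) * L ^ 2 := by
          rw [hL, Lam]; ring
        rw [hb, hA]
        nlinarith [sq_nonneg L]
      simpa [noLink, h] using pow_le_pow_left₀ hb0 hbA m
    · have hQ1 : Q ≤ lam μ K P i := by
        refine Finset.sum_le_sum fun j _ => mul_le_mul_of_nonneg_left ?_ (hμ0 j).le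
        rw [← hS, ← sum_keyWeight_meetInd (hK j)]
        exact Finset.sum_le_sum fun s _ => mul_le_mul_of_nonneg_left
          (mul_le_of_le_one_right (meetInd_nonneg _ _) (meetInd_le_one _ _))
          (keyWeight_nonneg _ _ _)
      have hbB : b ≤ B := by
        have h3 := mul_le_mul_of_nonneg_left hQ1 (sq_nonneg α)
        have h4 : α ^ 2 * lam μ K P i = α * L := by
          rw [hL, Lam]; ring
        rw [hb, hB]
        nlinarith [sq_nonneg L]
      have hpow := pow_le_pow_left₀ hb0 hbB m
      have hbm : 0 ≤ b ^ m := pow_nonneg hb0 m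
      simp only [noLink, h]
      nlinarith
  have step : ∀ S T : Finset (Fin P), keyWeight P (K i) S * (keyWeight P (K i) T *
      (noLink α S T * (∑ a, vertexWeight μ K a * (noLink α S a.2 * noLink α T a.2)) ^ m)) ≤
      keyWeight P (K i) S * (keyWeight P (K i) T * A ^ m +
        keyWeight P (K i) T * meetInd S T * (B ^ m - A ^ m)) := by
    intro S T
    by_cases hS : S.card = K i
    · refine mul_le_mul_of_nonneg_left ?_ (keyWeight_nonneg _ _ _)
      by_cases hT : T.card = K i
      · have := mul_le_mul_of_nonneg_left (key S T hS hT) (keyWeight_nonneg P (K i) T)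
        linarith
      · simp [keyWeight, hT]
    · simp [keyWeight, hS]
  have row : ∀ S : Finset (Fin P), keyWeight P (K i) S * ∑ T, keyWeight P (K i) T *
      (noLink α S T * (∑ a, vertexWeight μ K a * (noLink α S a.2 * noLink α T a.2)) ^ m) ≤
      keyWeight P (K i) S * (A ^ m + pEdge P (K i) (K i) * (B ^ m - A ^ m)) := by
    intro S
    have h := Finset.sum_le_sum fun T (_ : T ∈ Finset.univ) => step S T
    rw [← Finset.mul_sum, ← Finset.mul_sum, Finset.sum_add_distrib, ← Finset.sum_mul,
      ← Finset.sum_mul, sum_keyWeight (hK i), sum_keyWeight_meetInd (hK i), one_mul] at h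
    by_cases hS : S.card = K i
    · rwa [hS] at h
    · simp [keyWeight, hS]
  refine (Finset.sum_le_sum fun S _ => row S).trans ?_
  rw [← Finset.sum_mul, sum_keyWeight (hK i)]
  linarith

lemma one_add_div_pow_le_exp {x y : ℝ} (hy : 0 ≤ y) (hx : x ≠ 0) (m : ℕ) :
    (x ^ 2 + y) ^ m / (x ^ m) ^ 2 ≤ Real.exp (m * (y / x ^ 2)) := by
  have hx2 : 0 < x ^ 2 := by positivity
  have : (x ^ 2 + y) ^ m / (x ^ m) ^ 2 = (1 + y / x ^ 2) ^ m := by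
    rw [← pow_mul, mul_comm m 2, pow_mul, ← div_pow]
    congr 1
    field_simp
  rw [this, Real.exp_nat_mul]
  refine pow_le_pow_left₀ (by positivity) ?_ m
  linarith [Real.add_one_le_exp (y / x ^ 2)]

lemma mixture_ratio_le {p α L M ν N : ℝ} {m : ℕ} (hp0 : 0 ≤ p) (hp1 : p ≤ 1) (hα0 : 0 < α)
    (hα1 : α < 1) (hL0 : 0 ≤ L) (hL1 : L < 1) (hM : 0 ≤ M) (hν : 0 < ν)
    (hpL : α * (ν * p) ≤ L) (hmN : (m : ℝ) ≤ N) :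
    ((1 - p) * ((1 - L) ^ 2 + M * L ^ 2) ^ m + p * ((1 - L) ^ 2 + α * L) ^ m) /
      ((1 - L) ^ (m + 1)) ^ 2 ≤
    (Real.exp (M * (N * L ^ 2) / (1 - L) ^ 2) +
      (N * L ^ 2 * Real.exp (N * L / (1 - L) ^ 2)) / (ν * (1 - L) ^ 2)) / (1 - L) ^ 2 := by
  have hx : 1 - L ≠ 0 := by linarith
  have hD : 0 < (1 - L) ^ 2 := by positivity
  have hN : 0 ≤ N := le_trans (Nat.cast_nonneg m) hmN
  have hsplit : ((1 - p) * ((1 - L) ^ 2 + M * L ^ 2) ^ m + p * ((1 - L) ^ 2 + α * L) ^ m) /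
      ((1 - L) ^ (m + 1)) ^ 2 =
      ((1 - p) * (((1 - L) ^ 2 + M * L ^ 2) ^ m / ((1 - L) ^ m) ^ 2) +
        p * (((1 - L) ^ 2 + α * L) ^ m / ((1 - L) ^ m) ^ 2)) / (1 - L) ^ 2 := by
    rw [pow_succ (1 - L) m, mul_pow (_ ^ m)]
    field_simp
  rw [hsplit]
  refine div_le_div_of_nonneg_right ?_ hD.le
  set x := N * (α * L) / (1 - L) ^ 2 with hxdef
  set E := Real.exp (M * (N * L ^ 2) / (1 - L) ^ 2) with hE
  have hx0 : 0 ≤ x := by positivity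
  have hE1 : 1 ≤ E := Real.one_le_exp (by positivity)
  have hA : ((1 - L) ^ 2 + M * L ^ 2) ^ m / ((1 - L) ^ m) ^ 2 ≤ E := by
    refine (one_add_div_pow_le_exp (by positivity) hx m).trans (Real.exp_le_exp.2 ?_)
    rw [← mul_div_assoc]
    refine div_le_div_of_nonneg_right ?_ hD.le
    have := mul_le_mul_of_nonneg_right hmN (by positivity : 0 ≤ M * L ^ 2)
    linarith
  have hB : ((1 - L) ^ 2 + α * L) ^ m / ((1 - L) ^ m) ^ 2 ≤ Real.exp x := by
    refine (one_add_div_pow_le_exp (by positivity) hx m).trans (Real.exp_le_exp.2 ?_)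
    rw [← mul_div_assoc]
    exact div_le_div_of_nonneg_right (mul_le_mul_of_nonneg_right hmN (by positivity)) hD.le
  have hexp : Real.exp x - 1 ≤ x * Real.exp x := by
    have h1 := Real.add_one_le_exp (-x)
    have h2 : Real.exp (-x) * Real.exp x = 1 := by rw [← Real.exp_add]; simp
    nlinarith [Real.exp_pos x]
  have hxle : x ≤ N * L / (1 - L) ^ 2 := by
    refine div_le_div_of_nonneg_right (mul_le_mul_of_nonneg_left ?_ hN) hD.le
    nlinarith
  have hpx : p * x ≤ N * L ^ 2 / (ν * (1 - L) ^ 2) := by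
    rw [hxdef, ← mul_div_assoc, div_le_div_iff₀ hD (by positivity)]
    have := mul_le_mul_of_nonneg_left hpL (by positivity : 0 ≤ N * L * (1 - L) ^ 2)
    nlinarith
  have hlast : p * x * Real.exp x ≤
      N * L ^ 2 * Real.exp (N * L / (1 - L) ^ 2) / (ν * (1 - L) ^ 2) := by
    rw [mul_div_right_comm]
    exact mul_le_mul hpx (Real.exp_le_exp.2 hxle) (Real.exp_pos _).le (by positivity)
  have h1 := mul_le_mul_of_nonneg_left hA (by linarith : 0 ≤ 1 - p)
  have h2 := mul_le_mul_of_nonneg_left hB hp0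
  have h3 := mul_le_mul_of_nonneg_left hexp hp0
  nlinarith

lemma second_moment_ratio_le {m r P : ℕ} {μ : Fin r → ℝ} (hμ0 : ∀ i, 0 < μ i)
    (hμ : ∑ i, μ i = 1) {K : Fin r → ℕ} (hK : ∀ i, K i ≤ P) {α : ℝ} (hα0 : 0 < α)
    (hα1 : α < 1) (i : Fin r) {L : ℝ} (hL : Lam μ K P α i = L) (hL1 : L < 1) {N : ℝ}
    (hmN : (m : ℝ) ≤ N) :
    (μ i ^ 2 * ∑ S, keyWeight P (K i) S * ∑ T, keyWeight P (K i) T * (noLink α S T *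
      (∑ a, vertexWeight μ K a * (noLink α S a.2 * noLink α T a.2)) ^ m)) /
      (μ i * ∑ S, keyWeight P (K i) S *
        (∑ a, vertexWeight μ K a * noLink α S a.2) ^ (m + 1)) ^ 2 ≤
    (Real.exp ((∑ j, (μ j)⁻¹) * (N * L ^ 2) / (1 - L) ^ 2) +
      (N * L ^ 2 * Real.exp (N * L / (1 - L) ^ 2)) / (μ i * (1 - L) ^ 2)) / (1 - L) ^ 2 := by
  have hp0 : ∀ j, 0 ≤ pEdge P (K i) (K j) := fun j => pEdge_nonneg (hK j) _
  have hterm : ∀ j ∈ Finset.univ, 0 ≤ μ j * pEdge P (K i) (K j) :=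
    fun j _ => mul_nonneg (hμ0 j).le (hp0 j)
  have hL0 : 0 ≤ L := hL ▸ mul_nonneg hα0.le (Finset.sum_nonneg hterm)
  have hpL : α * (μ i * pEdge P (K i) (K i)) ≤ L :=
    hL ▸ mul_le_mul_of_nonneg_left (Finset.single_le_sum hterm (Finset.mem_univ i)) hα0.le
  have hle := sum_keyWeight_noLink_mul_le (m := m) hμ0 hμ hK hα0 hα1 i
  rw [sum_keyWeight_noLink_pow hμ hK, mul_pow, mul_div_mul_left _ _ (pow_pos (hμ0 i) 2).ne']
  rw [hL] at hle ⊢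
  exact (div_le_div_of_nonneg_right hle (by positivity)).trans
    (mixture_ratio_le (hp0 i) (pEdge_le_one _ _ _) hα0 hα1 hL0 hL1
      (Finset.sum_nonneg fun j _ => (inv_pos.2 (hμ0 j)).le) (hμ0 i) hpL hmN)

lemma tendsto_log_div_rpow {δ : ℝ} (hδ : 0 < δ) :
    Tendsto (fun n : ℕ => Real.log n / (n : ℝ) ^ δ) atTop (nhds 0) :=
  ((isLittleO_log_rpow_atTop hδ).tendsto_div_nhds_zero).comp tendsto_natCast_atTop_atTop

lemma tendsto_subcritical {cn : ℕ → ℝ} {c : ℝ} (hcn : Tendsto cn atTop (nhds c)) :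
    Tendsto (fun n : ℕ => cn n * Real.log n / n) atTop (nhds 0) := by
  have h := hcn.mul (tendsto_log_div_rpow one_pos)
  simpa [mul_div_assoc] using h

lemma tendsto_mul_sq_mul_exp {cn : ℕ → ℝ} {c : ℝ} (hcn : Tendsto cn atTop (nhds c))
    (hc1 : c < 1) :
    Tendsto (fun n : ℕ => n * (cn n * Real.log n / n) ^ 2 *
      Real.exp (n * (cn n * Real.log n / n) / (1 - cn n * Real.log n / n) ^ 2))
      atTop (nhds 0) := by
  set L : ℕ → ℝ := fun n => cn n * Real.log n / n with hLdef
  have hL : Tendsto L atTop (nhds 0) := tendsto_subcritical hcn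
  obtain ⟨c', hcc', hc'1⟩ := exists_between hc1
  have hd : Tendsto (fun n => cn n / (1 - L n) ^ 2) atTop (nhds c) := by
    have h := (hL.const_sub 1).pow 2
    rw [sub_zero, one_pow] at h
    simpa only [div_one] using! hcn.div h one_ne_zero
  have hδ : 0 < (1 - c') / 2 := by linarith
  have hbound : Tendsto (fun n : ℕ => (cn n * (Real.log n / (n : ℝ) ^ ((1 - c') / 2))) ^ 2)
      atTop (nhds 0) := by
    simpa using (hcn.mul (tendsto_log_div_rpow hδ)).pow 2
  refine squeeze_zero' (Eventually.of_forall fun n => by positivity) ?_ hbound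
  filter_upwards [hd.eventually_lt_const hcc', eventually_ge_atTop 1] with n hn hn1
  have hn0 : (0 : ℝ) < n := by exact_mod_cast hn1
  have hlog : 0 ≤ Real.log n := Real.log_natCast_nonneg n
  have hexp : Real.exp (n * (L n) / (1 - L n) ^ 2) ≤ (n : ℝ) ^ c' := by
    rw [Real.rpow_def_of_pos hn0, Real.exp_le_exp]
    have : n * L n / (1 - L n) ^ 2 = Real.log n * (cn n / (1 - L n) ^ 2) := by
      simp only [hLdef]
      field_simp
    rw [this]
    exact mul_le_mul_of_nonneg_left hn.le hlog
  have hpow : (n : ℝ) ^ c' * ((n : ℝ) ^ ((1 - c') / 2)) ^ 2 = n := by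
    rw [← Real.rpow_natCast, ← Real.rpow_mul hn0.le, ← Real.rpow_add hn0]
    norm_num
  have hq : 0 < (n : ℝ) ^ ((1 - c') / 2) := Real.rpow_pos_of_pos hn0 _
  calc n * L n ^ 2 * Real.exp (n * L n / (1 - L n) ^ 2)
      ≤ n * L n ^ 2 * (n : ℝ) ^ c' := by gcongr
    _ = (cn n * Real.log n) ^ 2 * ((n : ℝ) ^ c' / n) := by
        simp only [hLdef]
        field_simp
    _ = (cn n * Real.log n) ^ 2 / ((n : ℝ) ^ ((1 - c') / 2)) ^ 2 := by
        rw [div_eq_mul_inv _ (((n : ℝ) ^ ((1 - c') / 2)) ^ 2)]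
        congr 1
        rw [div_eq_iff hn0.ne', eq_comm, inv_mul_eq_iff_eq_mul₀ (by positivity), mul_comm, hpow]
    _ = _ := by rw [← mul_div_assoc, div_pow]

lemma tendsto_ratio_bound {cn : ℕ → ℝ} {c : ℝ} (hcn : Tendsto cn atTop (nhds c)) (hc0 : 0 < c)
    (hc1 : c < 1) (M : ℝ) {ν : ℝ} (hν : 0 < ν) :
    Tendsto (fun n : ℕ => (Real.exp (M * (n * (cn n * Real.log n / n) ^ 2) /
        (1 - cn n * Real.log n / n) ^ 2) +
      (n * (cn n * Real.log n / n) ^ 2 *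
        Real.exp (n * (cn n * Real.log n / n) / (1 - cn n * Real.log n / n) ^ 2)) /
        (ν * (1 - cn n * Real.log n / n) ^ 2)) / (1 - cn n * Real.log n / n) ^ 2)
      atTop (nhds 1) := by
  have hL := tendsto_subcritical hcn
  have hv := tendsto_mul_sq_mul_exp hcn hc1
  have hu : Tendsto (fun n : ℕ => n * (cn n * Real.log n / n) ^ 2) atTop (nhds 0) := by
    refine squeeze_zero' (Eventually.of_forall fun n => by positivity) ?_ hv
    filter_upwards [hcn.eventually_const_lt hc0] with n hn
    have hlog : 0 ≤ Real.log n := Real.log_natCast_nonneg n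
    exact le_mul_of_one_le_right (by positivity) (Real.one_le_exp (by positivity))
  have hD : Tendsto (fun n : ℕ => (1 - cn n * Real.log n / n) ^ 2) atTop (nhds 1) := by
    simpa using (hL.const_sub 1).pow 2
  have h1 := (Real.continuous_exp.tendsto _).comp ((hu.const_mul M).div hD one_ne_zero)
  have h2 := hv.div (hD.const_mul ν) (by simpa using hν.ne')
  have h3 := (h1.add h2).div hD one_ne_zero
  simp only [mul_zero, zero_div, Real.exp_zero, add_zero, div_one] at h3
  exact h3

end HetKey

open HetKey

open scoped Classical in
/-- with `x_{n,i}` the indicator that vertex `i` (for `i = 1, 2`) is of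
class 1 and isolated in `G(n; μ, K_n, P_n, α_n)`, if `Λ_1(n) = c_n log n / n` with
`c_n → c` and `0 < c < 1`, then `limsup_n E[x_{n,1} x_{n,2}] / (E[x_{n,1}])² ≤ 1`. -/
theorem limsup_second_moment_ratio_le_one
    (r : ℕ) (hr : 0 < r)
    (μ : Fin r → ℝ) (hμpos : ∀ i, 0 < μ i) (hμsum : ∑ i, μ i = 1)
    (K : ℕ → Fin r → ℕ) (Pn : ℕ → ℕ) (α : ℕ → ℝ)
    (hα0 : ∀ n, 0 < α n) (hα1 : ∀ n, α n < 1)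
    (hK1 : ∀ n i, 1 ≤ K n i)
    (hKmono : ∀ n, Monotone (K n))
    (hKP : ∀ n i, 2 * K n i ≤ Pn n)
    (cn : ℕ → ℝ) (c : ℝ)
    (hcn : Tendsto cn atTop (nhds c)) (hc0 : 0 < c) (hc1 : c < 1)
    (hΛ : ∀ n, 2 ≤ n →
      Lam μ (K n) (Pn n) (α n) ⟨0, hr⟩ = cn n * Real.log n / n) :
    Filter.limsup
      (fun n : ℕ =>
        if hn : 2 ≤ n then
          (expect (n := n) (P := Pn n) μ (K n) (α n)
            (fun cfg =>
              (if cfg.1 ⟨0, by omega⟩ = ⟨0, hr⟩ ∧ isolated cfg ⟨0, by omega⟩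
                then (1 : ℝ) else 0) *
              (if cfg.1 ⟨1, by omega⟩ = ⟨0, hr⟩ ∧ isolated cfg ⟨1, by omega⟩
                then (1 : ℝ) else 0))) /
          (expect (n := n) (P := Pn n) μ (K n) (α n)
            (fun cfg =>
              if cfg.1 ⟨0, by omega⟩ = ⟨0, hr⟩ ∧ isolated cfg ⟨0, by omega⟩
              then (1 : ℝ) else 0)) ^ 2
        else 0)
      atTop ≤ 1 := by
  have hK : ∀ n i, K n i ≤ Pn n := fun n i => by have := hKP n i; omega
  have hg := tendsto_ratio_bound hcn hc0 hc1 (∑ j, (μ j)⁻¹) (hμpos ⟨0, hr⟩)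
  refine le_trans (limsup_le_limsup ?_ ?_ hg.isBoundedUnder_le) hg.limsup_eq.le
  · filter_upwards [eventually_ge_atTop 2,
      (tendsto_subcritical hcn).eventually_lt_const one_pos] with n hn hL1
    rw [dif_pos hn]
    obtain ⟨m, rfl⟩ : ∃ m, n = m + 2 := ⟨n - 2, by omega⟩
    have hratio := second_moment_ratio_le (m := m) hμpos hμsum (hK (m + 2)) (hα0 _) (hα1 _)
      ⟨0, hr⟩ (hΛ (m + 2) hn) hL1 (N := ((m + 2 : ℕ) : ℝ)) (by push_cast; linarith)
    rw [← expect_isolated_mul μ (K (m + 2)) _ _ (by omega) (by omega),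
      ← expect_isolated μ (K (m + 2)) _ _ (by omega)] at hratio
    exact hratio
  · refine IsCoboundedUnder.of_frequently_ge (a := 0) (Eventually.frequently ?_)
    refine Eventually.of_forall fun n => ?_
    split_ifs with hn
    · refine div_nonneg (Finset.sum_nonneg fun cfg _ => mul_nonneg ?_ ?_) (sq_nonneg _)
      · exact weight_nonneg hμpos _ (hα0 n).le (hα1 n).le cfg
      · beta_reduce
        split_ifs <;> norm_num
    · exact le_rfl
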